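/- arXiv:2407.01828 — 2 statements merged into one kernel-verified Lean document; each statement's English description precedes it below -/
import Mathlib

section
/- The entropy of the zip shift σ relative to the partition 𝒞_0 equals the entropy of that partition: h_μ(σ, 𝒞_0) := lim_{n→∞} (1/n) H_μ(⋁_{j=0}^{n−1} σ^{−j}(𝒞_0)) = H_μ(𝒞_0). -/
open MeasureTheory Filter Real

namespace ZipShiftPaper

variable {Sm Sp : Type*}

/-- `s` is an admissible symbol for index `i`: a negative symbol (inl) if `i < 0`,
a positive symbol (inr) if `i ≥ 0`. -/
def Adm (i : ℤ) (s : Sm ⊕ Sp) : Prop :=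
  if i < 0 then s.isLeft = true else s.isRight = true

/-- The zip shift space: bilateral sequences with positive symbols on indices `≥ 0`
and negative symbols on indices `< 0`. -/
def ZipSpace (Sm Sp : Type*) := {x : ℤ → Sm ⊕ Sp // ∀ i, Adm i (x i)}

variable (φ : Sp → Sm)

/-- The transition function applied to a combined symbol. -/
def phiHat : Sm ⊕ Sp → Sm ⊕ Sp
  | .inl t => .inl t
  | .inr s => .inl (φ s)

lemma adm_shift (x : ZipSpace Sm Sp) (i : ℤ) :
    Adm i (if i = -1 then phiHat φ (x.1 0) else x.1 (i + 1)) := by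
  by_cases h : i = -1
  · subst h
    have h0 := x.2 0
    simp only [Adm, if_neg (by norm_num : ¬ (0:ℤ) < 0)] at h0
    simp only [if_pos rfl, Adm, if_pos (by norm_num : (-1:ℤ) < 0)]
    rcases hx : x.1 0 with t | s
    · rw [hx] at h0; simp at h0
    · simp [phiHat]
  · rw [if_neg h]
    have h1 := x.2 (i + 1)
    unfold Adm at h1 ⊢
    by_cases hi : i < 0
    · rw [if_pos hi]; rw [if_pos (by omega)] at h1; exact h1
    · rw [if_neg hi]; rw [if_neg (by omega)] at h1; exact h1

/-- The zip shift map `σ_φ`. -/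
def zipShift (x : ZipSpace Sm Sp) : ZipSpace Sm Sp :=
  ⟨fun i => if i = -1 then phiHat φ (x.1 0) else x.1 (i + 1), adm_shift φ x⟩

/-- The cylinder `C^s_i = {x : x_i = s}`. -/
def cyl (i : ℤ) (s : Sm ⊕ Sp) : Set (ZipSpace Sm Sp) := {x | x.1 i = s}

/-- The σ-algebra on the zip shift space, generated by the cylinders. -/
instance zipMS : MeasurableSpace (ZipSpace Sm Sp) :=
  .generateFrom {C | ∃ i s, C = cyl i s}

/-- The partition `𝒞_i` of `Σ` by cylinders of index `i`. -/
def cylPart (i : ℤ) : Set (Set (ZipSpace Sm Sp)) :=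
  {C | ∃ s : Sm ⊕ Sp, Adm i s ∧ C = cyl i s}

/-- Forward image of a partition: `f(P) = {f(A) : A ∈ P}`. -/
def pushPart {α : Type*} (f : α → α) (P : Set (Set α)) : Set (Set α) :=
  (Set.image f) '' P

/-- Pullback of a partition: `f⁻¹(P) = {f⁻¹(A) : A ∈ P}`. -/
def pullPart {α : Type*} (f : α → α) (P : Set (Set α)) : Set (Set α) :=
  (Set.preimage f) '' P

/-- `σ^j(P)` for `j : ℤ`: forward image for `j ≥ 0`, preimage for `j < 0`. -/
def powPart {α : Type*} (f : α → α) (j : ℤ) (P : Set (Set α)) : Set (Set α) :=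
  if 0 ≤ j then pushPart (f^[j.toNat]) P else pullPart (f^[(-j).toNat]) P

/-- Common refinement (correfinement) `⋁_{i ∈ t} P i` of a family of partitions:
all nonempty intersections of one element from each partition. -/
def corefine {α ι : Type*} (t : Set ι) (P : ι → Set (Set α)) : Set (Set α) :=
  {A | A.Nonempty ∧ ∃ g : ι → Set α, (∀ i ∈ t, g i ∈ P i) ∧ A = ⋂ i ∈ t, g i}

/-- The partition `𝒞_{n,…,n'}` by cylinders of indices from `n` to `n'`. -/
def cylRange (n n' : ℤ) : Set (Set (ZipSpace Sm Sp)) :=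
  corefine (Set.Icc n n') cylPart

/-- The `k`-th dynamical correfinement `⋁_{j=0}^{k-1} f^{-j}(P)`. -/
def dynRefine {α : Type*} (f : α → α) (P : Set (Set α)) (k : ℕ) : Set (Set α) :=
  corefine (Set.Iio k) (fun j : ℕ => pullPart (f^[j]) P)

/-- Entropy of a partition: `H_μ(P) = Σ_{A ∈ P} -μ(A) log μ(A)`. -/
noncomputable def partH {α : Type*} [MeasurableSpace α] (μ : Measure α)
    (P : Set (Set α)) : ℝ :=
  ∑' A : P, Real.negMulLog ((μ (A : Set α)).toReal)

variable (pp : Sp → ℝ) [Fintype Sp] [DecidableEq Sm]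

/-- The pushforward distribution `p⁻ = φ_* p⁺` on the negative symbols. -/
def pm (t : Sm) : ℝ := ∑ s ∈ Finset.univ.filter (fun s => φ s = t), pp s

/-- The weight of symbol `s` at coordinate `i`: `p⁺_s` for a positive symbol at `i ≥ 0`,
`p⁻_s` for a negative symbol at `i < 0`, and `0` for inadmissible pairs. -/
def wt : ℤ → Sm ⊕ Sp → ℝ
  | i, .inl t => if i < 0 then pm φ pp t else 0
  | i, .inr s => if 0 ≤ i then pp s else 0

/-- `μ` is the product measure determined by `p⁺` (coordinates independent, coordinate `i`
distributed as `p⁺` for `i ≥ 0` and as `p⁻ = φ_* p⁺` for `i < 0`). -/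
def IsProductMeasure (μ : Measure (ZipSpace Sm Sp)) : Prop :=
  ∀ (F : Finset ℤ) (c : ℤ → Sm ⊕ Sp),
    μ {x : ZipSpace Sm Sp | ∀ i ∈ F, x.1 i = c i}
      = ∏ i ∈ F, ENNReal.ofReal (wt φ pp i (c i))

/-- The fiber space `σ⁻¹(ε) = {σ⁻¹({x}) : x ∈ Σ}`: the partition of `Σ` into
preimages of points, viewed as a type. -/
def Fib (φ : Sp → Sm) := {A : Set (ZipSpace Sm Sp) // ∃ x, A = zipShift φ ⁻¹' {x}}

/-- The natural projection `π : Σ → σ⁻¹(ε)`, `π(y) = σ⁻¹({σ(y)})`. -/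
def fibProj (y : ZipSpace Sm Sp) : Fib φ :=
  ⟨zipShift φ ⁻¹' {zipShift φ y}, zipShift φ y, rfl⟩

/-- The quotient σ-algebra on `σ⁻¹(ε)`:
`Q` is measurable iff `π⁻¹(Q)` is measurable in `Σ`. -/
instance fibMS : MeasurableSpace (Fib φ) :=
  MeasurableSpace.map (fibProj φ) (zipMS)

/-- `X̂ = {x̂ : x ∈ X}`, the set of fibers of points of `X`. -/
def hatSet (X : Set (ZipSpace Sm Sp)) : Set (Fib φ) :=
  {A | ∃ x ∈ X, A.1 = zipShift φ ⁻¹' {x}}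

/-- The negative symbol `x_{-1}` of a point of the zip shift space. -/
def negSym (x : ZipSpace Sm Sp) : Sm :=
  (x.1 (-1)).getLeft (by
    have h := x.2 (-1)
    simpa [Adm, if_pos (by norm_num : (-1:ℤ) < 0)] using h)

/-- The preimage `x̂(s) = (…, x_{-2}; s, x_0, x_1, …)` of `x` under the zip shift,
determined by the choice of positive symbol `s ∈ φ⁻¹(x_{-1})` at coordinate `0`. -/
def prePoint (x : ZipSpace Sm Sp) (s : Sp) : ZipSpace Sm Sp :=
  ⟨fun j => if j = 0 then .inr s else x.1 (j - 1), by
    intro j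
    dsimp only
    by_cases h : j = 0
    · subst h
      simp [Adm]
    · rw [if_neg h]
      have h1 := x.2 (j - 1)
      unfold Adm at h1 ⊢
      by_cases hj : j < 0
      · rw [if_pos hj]; rw [if_pos (by omega)] at h1; exact h1
      · rw [if_neg hj]; rw [if_neg (by omega)] at h1; exact h1⟩

/-- The conditional measure `μ_{x̂}` on the fiber `x̂ = σ⁻¹({x})`, giving mass
`q^{x_{-1}}_s = p⁺_s / p⁻_{x_{-1}}` to the point `x̂(s)`, `s ∈ φ⁻¹(x_{-1})`. -/
noncomputable def condMeas (x : ZipSpace Sm Sp) : Measure (ZipSpace Sm Sp) :=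
  ∑ s ∈ Finset.univ.filter (fun s => φ s = negSym x),
    (ENNReal.ofReal (pp s / pm φ pp (negSym x))) • Measure.dirac (prePoint x s)

/-- The conditional measure attached to a fiber `A ∈ σ⁻¹(ε)`. -/
noncomputable def condMeasFib (A : Fib φ) : Measure (ZipSpace Sm Sp) :=
  condMeas φ pp A.2.choose

/-- The entropy `H_{μ_{x̂}}(ε|_{x̂})` of the restriction of the atomic partition to the
fiber `x̂`, with respect to the conditional measure `μ_{x̂}`. -/
noncomputable def fibH (A : Fib φ) : ℝ :=
  ∑' y : A.1,
    Real.negMulLog ((condMeasFib φ pp A {(y : ZipSpace Sm Sp)}).toReal)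

/-- The folding entropy `F(σ) = ∫ H_{μ_{x̂}}(ε|_{x̂}) dμ̂(x̂)`, where `μ̂ = π_* μ` is the
quotient measure on `σ⁻¹(ε)`. -/
noncomputable def foldH (μ : Measure (ZipSpace Sm Sp)) : ℝ :=
  ∫ A, fibH φ pp A ∂(μ.map (fibProj φ))

/-- A finite measurable partition (mod 0) of a probability space. -/
def IsFinPart {α : Type*} [MeasurableSpace α] (μ : Measure α) (P : Set (Set α)) : Prop :=
  P.Finite ∧ (∀ A ∈ P, MeasurableSet A) ∧ P.Pairwise Disjoint ∧ μ (⋃₀ P) = 1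


/-- The Kolmogorov–Sinai entropy: the supremum, over all finite measurable partitions `P`,
of the limits `h_μ(f, P) = lim_n H_μ(⋁_{j=0}^{n-1} f^{-j}P)/n`. -/
noncomputable def ksEntropy {α : Type*} [MeasurableSpace α] (μ : Measure α) (f : α → α) : ℝ :=
  sSup {h : ℝ | ∃ P : Set (Set α), IsFinPart μ P ∧
    Tendsto (fun n : ℕ => partH μ (dynRefine f P n) / n) atTop (nhds h)}


end ZipShiftPaper

open ZipShiftPaper


namespace ZipShiftPaper

section SymbolicWords

variable {Sm Sp : Type*}

lemma zipShift_iterate_apply_natCast (φ : Sp → Sm) (j k : ℕ) (x : ZipSpace Sm Sp) :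
    ((zipShift φ)^[j] x).1 k = x.1 ((j + k : ℕ) : ℤ) := by
  induction j generalizing k with
  | zero => simp
  | succ j ih =>
    rw [Function.iterate_succ_apply']
    simp only [zipShift]
    rw [if_neg (by omega)]
    have := ih (k + 1)
    push_cast at this ⊢
    rw [this, add_right_comm, add_assoc]

lemma adm_zero_iff {s : Sm ⊕ Sp} : Adm 0 s ↔ ∃ a : Sp, s = .inr a := by
  simp [Adm, Sum.isRight_iff]

/-- The set of points whose coordinates `0, …, n - 1` spell the word `w`. -/
def wordCyl (Sm : Type*) {Sp : Type*} {n : ℕ} (w : Fin n → Sp) : Set (ZipSpace Sm Sp) :=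
  {x | ∀ j : Fin n, x.1 (j : ℕ) = .inr (w j)}

lemma wordCyl_nonempty [Nonempty Sm] [Nonempty Sp] {n : ℕ} (w : Fin n → Sp) :
    (wordCyl Sm w).Nonempty := by
  inhabit Sm
  inhabit Sp
  refine ⟨⟨fun i => if i < 0 then .inl default
    else .inr (if h : i.toNat < n then w ⟨i.toNat, h⟩ else default), fun i => ?_⟩, fun j => ?_⟩
  · unfold Adm
    split_ifs with h <;> simp [h]
  · simp

lemma wordCyl_injective [Nonempty Sm] [Nonempty Sp] (n : ℕ) :
    Function.Injective (wordCyl Sm : (Fin n → Sp) → Set (ZipSpace Sm Sp)) := by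
  intro v w h
  obtain ⟨x, hx⟩ := wordCyl_nonempty (Sm := Sm) v
  have hx' : x ∈ wordCyl Sm w := h ▸ hx
  funext j
  exact Sum.inr_injective ((hx j).symm.trans (hx' j))

lemma dynRefine_cylPart_zero [Nonempty Sm] [Nonempty Sp] (φ : Sp → Sm) (n : ℕ) :
    dynRefine (zipShift φ) (cylPart 0) n = Set.range (wordCyl Sm : (Fin n → Sp) → _) := by
  have hpre (j : ℕ) (a : Sp) (x : ZipSpace Sm Sp) :
      x ∈ (zipShift φ)^[j] ⁻¹' cyl 0 (.inr a) ↔ x.1 j = .inr a := by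
    simpa [cyl] using iff_of_eq
      (congrArg (· = Sum.inr a) (zipShift_iterate_apply_natCast φ j 0 x))
  ext A
  constructor
  · rintro ⟨-, g, hg, rfl⟩
    have hw (j : Fin n) : ∃ a : Sp, g j = (zipShift φ)^[j] ⁻¹' cyl 0 (.inr a) := by
      obtain ⟨_, ⟨s, hs, rfl⟩, h⟩ := hg j j.2
      obtain ⟨a, rfl⟩ := adm_zero_iff.1 hs
      exact ⟨a, h.symm⟩
    choose w hw using hw
    refine ⟨w, Set.ext fun x => ?_⟩
    simp only [Set.mem_iInter, Set.mem_Iio]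
    constructor
    · intro hx j hj
      exact hw ⟨j, hj⟩ ▸ (hpre j _ x).2 (hx ⟨j, hj⟩)
    · intro hx j
      exact (hpre j _ x).1 (hw j ▸ hx j j.2)
  · rintro ⟨w, rfl⟩
    inhabit Sp
    let a (j : ℕ) : Sp := if h : j < n then w ⟨j, h⟩ else default
    have ha (j : Fin n) : a j = w j := by simp [a]
    refine ⟨wordCyl_nonempty w, fun j => (zipShift φ)^[j] ⁻¹' cyl 0 (.inr (a j)),
      fun j _ => ⟨_, ⟨_, adm_zero_iff.2 ⟨a j, rfl⟩, rfl⟩, rfl⟩, Set.ext fun x => ?_⟩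
    simp only [Set.mem_iInter, Set.mem_Iio, hpre]
    constructor
    · intro hx j hj
      exact (hx ⟨j, hj⟩).trans (congrArg Sum.inr (ha ⟨j, hj⟩).symm)
    · intro hx j
      exact (hx j j.2).trans (congrArg Sum.inr (ha j))

lemma cylPart_zero_eq_range_wordCyl :
    (cylPart 0 : Set (Set (ZipSpace Sm Sp))) =
      Set.range (wordCyl Sm : (Fin 1 → Sp) → _) := by
  have hcyl (w : Fin 1 → Sp) : wordCyl Sm w = cyl 0 (.inr (w 0)) := by
    ext x
    simp [wordCyl, cyl]
  ext A
  constructor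
  · rintro ⟨s, hs, rfl⟩
    obtain ⟨a, rfl⟩ := adm_zero_iff.1 hs
    exact ⟨fun _ => a, hcyl _⟩
  · rintro ⟨w, rfl⟩
    exact ⟨_, adm_zero_iff.2 ⟨w 0, rfl⟩, hcyl w⟩

lemma IsProductMeasure.measure_wordCyl [Fintype Sp] [DecidableEq Sm] [Nonempty Sp]
    {φ : Sp → Sm} {pp : Sp → ℝ} {μ : Measure (ZipSpace Sm Sp)}
    (hμ : IsProductMeasure φ pp μ) {n : ℕ} (w : Fin n → Sp) :
    μ (wordCyl Sm w) = ∏ j, ENNReal.ofReal (pp (w j)) := by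
  inhabit Sp
  let c (i : ℤ) : Sm ⊕ Sp := .inr (if h : i.toNat < n then w ⟨i.toNat, h⟩ else default)
  have hc (j : Fin n) : c (j : ℕ) = .inr (w j) := by simp [c]
  have hinj : Function.Injective fun j : Fin n => ((j : ℕ) : ℤ) :=
    Nat.cast_injective.comp Fin.val_injective
  have h := hμ (Finset.univ.map ⟨_, hinj⟩) c
  rw [Finset.prod_map] at h
  simp only [Finset.mem_map, Finset.mem_univ, true_and, forall_exists_index,
    forall_apply_eq_imp_iff, Function.Embedding.coeFn_mk, hc] at h
  simpa [wordCyl, wt] using h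

end SymbolicWords

/-- The Shannon entropy of `n` independent copies of a finite distribution is `n` times the
entropy of one copy. -/
lemma sum_negMulLog_prod {ι : Type*} [Fintype ι] (p : ι → ℝ) (hp : ∑ s, p s = 1) (n : ℕ) :
    ∑ w : Fin n → ι, negMulLog (∏ j, p (w j)) = n * ∑ s, negMulLog (p s) := by
  induction n with
  | zero => simp
  | succ n ih =>
    have hone : ∑ w : Fin n → ι, ∏ j, p (w j) = 1 := by
      rw [← Fintype.sum_pow, hp, one_pow]
    rw [← (Fin.consEquiv fun _ => ι).sum_comp, Fintype.sum_prod_type]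
    simp only [Fin.consEquiv_apply, Fin.prod_univ_succ, Fin.cons_zero, Fin.cons_succ,
      negMulLog_mul, Finset.sum_add_distrib, ← Finset.sum_mul, ← Finset.mul_sum, hone, hp, ih]
    push_cast
    ring

lemma IsProductMeasure.partH_range_wordCyl {Sm Sp : Type*} [Fintype Sp] [DecidableEq Sm]
    [Nonempty Sm] [Nonempty Sp] {φ : Sp → Sm} {pp : Sp → ℝ} (hpp : ∀ s, 0 ≤ pp s)
    (hsum : ∑ s, pp s = 1) {μ : Measure (ZipSpace Sm Sp)} (hμ : IsProductMeasure φ pp μ)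
    (n : ℕ) :
    partH μ (Set.range (wordCyl Sm : (Fin n → Sp) → _)) = n * ∑ s, negMulLog (pp s) := by
  rw [← sum_negMulLog_prod pp hsum, partH,
    tsum_range (fun A => negMulLog (μ A).toReal) (wordCyl_injective n), tsum_fintype]
  simp [hμ.measure_wordCyl, ENNReal.toReal_prod, hpp]

end ZipShiftPaper

/-- `h_μ(σ, 𝒞_0) = lim_n H_μ(⋁_{j<n} σ^{-j} 𝒞_0)/n = H_μ(𝒞_0)`. -/
theorem statement8 {Sm Sp : Type*} [Fintype Sm] [Fintype Sp] [Nonempty Sm] [Nonempty Sp]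
    [DecidableEq Sm]
    (φ : Sp → Sm) (hφ : Function.Surjective φ)
    (pp : Sp → ℝ) (hpp : ∀ s, 0 ≤ pp s) (hsum : ∑ s, pp s = 1)
    (μ : Measure (ZipSpace Sm Sp)) (hμ : IsProductMeasure φ pp μ) :
    Tendsto (fun n : ℕ => partH μ (dynRefine (zipShift φ) (cylPart 0) n) / (n : ℝ))
      atTop (nhds (partH μ (cylPart 0))) := by
  rw [cylPart_zero_eq_range_wordCyl, hμ.partH_range_wordCyl hpp hsum, Nat.cast_one, one_mul]
  refine tendsto_const_nhds.congr' ?_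
  filter_upwards [eventually_ne_atTop 0] with n hn
  rw [← cylPart_zero_eq_range_wordCyl, dynRefine_cylPart_zero,
    hμ.partH_range_wordCyl hpp hsum, mul_div_cancel_left₀ _ (Nat.cast_ne_zero.2 hn)]
end

section
/- For every n ≥ 1, the entropy of the zip shift σ relative to the partition 𝒫_n := 𝒞_{−n,…,n−1} equals H_μ(𝒞_0): h_μ(σ, 𝒫_n) := lim_{k→∞} (1/k) H_μ(⋁_{j=0}^{k−1} σ^{−j}(𝒫_n)) = H_μ(𝒞_0). -/
open MeasureTheory Filter Real

open ZipShiftPaper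


namespace ZipShiftPaper

/-- The partition of `α` into the nonempty fibers of `f`. -/
def fibPart {α β : Type*} (f : α → β) : Set (Set α) :=
  {A | ∃ x, A = {y | f y = f x}}

lemma fibPart_congr {α β γ : Type*} {f : α → β} {g : α → γ}
    (h : ∀ x y, f x = f y ↔ g x = g y) : fibPart f = fibPart g := by
  simp only [fibPart, h]

lemma pullPart_fibPart {α β : Type*} {g : α → α} (hg : Function.Surjective g) (f : α → β) :
    pullPart g (fibPart f) = fibPart (f ∘ g) := by
  ext A
  constructor
  · rintro ⟨_, ⟨x, rfl⟩, rfl⟩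
    obtain ⟨x', rfl⟩ := hg x
    exact ⟨x', rfl⟩
  · rintro ⟨x, rfl⟩
    exact ⟨_, ⟨g x, rfl⟩, rfl⟩

lemma corefine_fibPart {α ι β : Type*} (t : Set ι) (f : ι → α → β) :
    corefine t (fun i => fibPart (f i)) = fibPart (fun x (i : t) => f i x) := by
  ext A
  constructor
  · rintro ⟨⟨x, hx⟩, g, hg, rfl⟩
    refine ⟨x, ?_⟩
    ext y
    simp only [Set.mem_iInter, Set.mem_ofPred_eq, funext_iff, Subtype.forall] at hx ⊢
    refine forall₂_congr fun i hi => ?_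
    obtain ⟨z, hz⟩ := hg i hi
    have hxz := hx i hi
    rw [hz, Set.mem_ofPred_eq] at hxz
    rw [hz, Set.mem_ofPred_eq, hxz]
  · rintro ⟨x, rfl⟩
    refine ⟨⟨x, rfl⟩, fun i => {y | f i y = f i x}, fun i _ => ⟨x, rfl⟩, ?_⟩
    ext y
    simp [funext_iff]

lemma partH_fibPart {α β : Type*} [MeasurableSpace α] [Fintype β] (μ : Measure α) (f : α → β) :
    partH μ (fibPart f) = ∑ b, Real.negMulLog (μ {y | f y = b}).toReal := by
  let e : fibPart f → β := fun A => f A.2.choose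
  have he : ∀ A : fibPart f, (A : Set α) = {y | f y = e A} := fun A => A.2.choose_spec
  have hinj : Function.Injective e := fun A B h => Subtype.ext (by rw [he A, he B, h])
  rw [partH, ← tsum_fintype (L := .unconditional β),
    ← hinj.tsum_eq (f := fun b => Real.negMulLog (μ {y | f y = b}).toReal)]
  · exact tsum_congr fun A => by rw [he A]
  · intro b hb
    by_contra hne
    refine hb ?_
    have hempty : {y | f y = b} = ∅ := by
      refine Set.eq_empty_iff_forall_notMem.2 fun x hx => hne ?_
      let A : fibPart f := ⟨{y | f y = f x}, x, rfl⟩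
      have hxA : x ∈ (A : Set α) := rfl
      rw [he A] at hxA
      exact ⟨A, hxA.symm.trans hx⟩
    simp [hempty]

lemma negMulLog_prod {ι : Type*} [DecidableEq ι] (F : Finset ι) (w : ι → ℝ) :
    Real.negMulLog (∏ i ∈ F, w i)
      = ∑ i ∈ F, ∏ j ∈ F, if j = i then Real.negMulLog (w j) else w j := by
  induction F using Finset.induction_on with
  | empty => simp
  | insert a F ha ih =>
    rw [Finset.prod_insert ha, Real.negMulLog_mul, ih, Finset.sum_insert ha,
      Finset.prod_insert ha, if_pos rfl, Finset.mul_sum]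
    congr 1
    · rw [mul_comm]
      congr 1
      exact Finset.prod_congr rfl fun j hj => (if_neg (ne_of_mem_of_not_mem hj ha)).symm
    · refine Finset.sum_congr rfl fun i hi => ?_
      rw [Finset.prod_insert ha, if_neg (ne_of_mem_of_not_mem hi ha).symm]

/-- Additivity of the entropy of a finite product of probability vectors. -/
lemma sum_negMulLog_prod_s10 {ι β : Type*} [Fintype ι] [DecidableEq ι] [Fintype β]
    (w : ι → β → ℝ) (hw : ∀ i, ∑ b, w i b = 1) :
    ∑ c : ι → β, Real.negMulLog (∏ i, w i (c i)) = ∑ i, ∑ b, Real.negMulLog (w i b) := by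
  simp_rw [negMulLog_prod]
  rw [Finset.sum_comm]
  refine Finset.sum_congr rfl fun i _ => ?_
  rw [← Fintype.prod_sum (fun j b => if j = i then Real.negMulLog (w j b) else w j b),
    Finset.prod_eq_single i]
  · simp
  · intro j _ hj
    simp [hj, hw]
  · simp

section Shift

variable {Sm Sp : Type*} (φ : Sp → Sm)

lemma exists_zipSpace [Nonempty Sm] [Nonempty Sp] {i : ℤ} {s : Sm ⊕ Sp} (hs : Adm i s) :
    ∃ x : ZipSpace Sm Sp, x.1 i = s := by
  obtain ⟨a⟩ := ‹Nonempty Sm›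
  obtain ⟨b⟩ := ‹Nonempty Sp›
  refine ⟨⟨fun j => if j = i then s else if j < 0 then .inl a else .inr b, fun j => ?_⟩, by simp⟩
  by_cases h : j = i
  · subst h
    simpa using hs
  · by_cases hj : j < 0 <;> simp [Adm, h, hj]

lemma cylPart_eq_fibPart [Nonempty Sm] [Nonempty Sp] (i : ℤ) :
    cylPart i = fibPart (fun x : ZipSpace Sm Sp => x.1 i) := by
  ext A
  constructor
  · rintro ⟨s, hs, rfl⟩
    obtain ⟨x, rfl⟩ := exists_zipSpace hs
    exact ⟨x, rfl⟩
  · rintro ⟨x, rfl⟩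
    exact ⟨x.1 i, x.2 i, rfl⟩

lemma phiHat_eq_self_of_neg (x : ZipSpace Sm Sp) {i : ℤ} (hi : i < 0) :
    phiHat φ (x.1 i) = x.1 i := by
  have h := x.2 i
  rw [Adm, if_pos hi] at h
  obtain ⟨a, ha⟩ := Sum.isLeft_iff.1 h
  rw [ha, phiHat]

variable {φ} in
lemma zipShift_surjective (hφ : Function.Surjective φ) :
    Function.Surjective (zipShift φ : ZipSpace Sm Sp → ZipSpace Sm Sp) := by
  intro x
  obtain ⟨s, hs⟩ := hφ (negSym x)
  refine ⟨prePoint x s, Subtype.ext (funext fun i => ?_)⟩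
  by_cases h : i = -1
  · subst h
    simp [zipShift, prePoint, phiHat, hs, negSym]
  · have : i + 1 ≠ 0 := by omega
    simp [zipShift, prePoint, h, this]

lemma zipShift_iterate_apply (j : ℕ) (x : ZipSpace Sm Sp) (i : ℤ) :
    ((zipShift φ)^[j] x).1 i = if i < 0 then phiHat φ (x.1 (i + j)) else x.1 (i + j) := by
  induction j generalizing i with
  | zero =>
    split_ifs with hi
    · simp [phiHat_eq_self_of_neg φ x hi]
    · simp
  | succ j ih =>
    rw [Function.iterate_succ_apply', zipShift]
    dsimp only
    by_cases h : i = -1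
    · subst h
      simp [ih]
    · rw [if_neg h, ih, show i + 1 + (j : ℤ) = i + ((j + 1 : ℕ) : ℤ) by push_cast; ring]
      by_cases hi : i < 0
      · rw [if_pos hi, if_pos (by omega)]
      · rw [if_neg hi, if_neg (by omega)]

variable {φ} in
lemma dynRefine_cylRange [Nonempty Sm] [Nonempty Sp] (hφ : Function.Surjective φ)
    {n k : ℕ} (hn : 1 ≤ n) (hk : 1 ≤ k) :
    dynRefine (zipShift φ) (cylRange (-(n : ℤ)) ((n : ℤ) - 1)) k
      = fibPart (fun (x : ZipSpace Sm Sp) (i : Finset.Ico (-(n : ℤ)) (n + k - 1)) => x.1 i) := by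
  have hcyl : (cylPart : ℤ → Set (Set (ZipSpace Sm Sp)))
      = fun i => fibPart (fun x => x.1 i) := funext cylPart_eq_fibPart
  have hpull : ∀ j : ℕ, pullPart ((zipShift φ)^[j]) (cylRange (-(n : ℤ)) ((n : ℤ) - 1))
      = fibPart ((fun (x : ZipSpace Sm Sp) (i : Set.Icc (-(n : ℤ)) (n - 1)) => x.1 i)
          ∘ (zipShift φ)^[j]) := fun j => by
    rw [cylRange, hcyl, corefine_fibPart, pullPart_fibPart ((zipShift_surjective hφ).iterate j)]
  simp_rw [dynRefine, hpull]
  rw [corefine_fibPart]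
  refine fibPart_congr fun x y => ?_
  simp only [funext_iff, Function.comp_apply, Subtype.forall, Set.mem_Iio, Set.mem_Icc,
    Finset.mem_Ico, zipShift_iterate_apply]
  constructor
  · rintro h m ⟨hm₁, hm₂⟩
    rcases lt_or_ge m n with hm | hm
    · have := h 0 hk m ⟨hm₁, by omega⟩
      rcases lt_or_ge m 0 with hm₀ | hm₀
      · simpa [hm₀, phiHat_eq_self_of_neg φ _ hm₀] using this
      · simpa [not_lt.2 hm₀] using this
    · have := h (m - (n - 1)).toNat (by omega) (n - 1) ⟨by omega, le_rfl⟩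
      rwa [if_neg (by omega), if_neg (by omega),
        show (n : ℤ) - 1 + ((m - (n - 1)).toNat : ℤ) = m by omega] at this
  · rintro h j hj i ⟨hi₁, hi₂⟩
    rw [h (i + j) ⟨by omega, by omega⟩]

variable [Fintype Sp] [DecidableEq Sm] (pp : Sp → ℝ)

variable {pp} in
lemma wt_nonneg (hpp : ∀ s, 0 ≤ pp s) (i : ℤ) (s : Sm ⊕ Sp) : 0 ≤ wt φ pp i s := by
  rcases s with t | s
  · rw [wt]
    split_ifs
    exacts [Finset.sum_nonneg fun s _ => hpp s, le_rfl]
  · rw [wt]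
    split_ifs
    exacts [hpp s, le_rfl]

variable [Fintype Sm]

lemma sum_pm : ∑ t, pm φ pp t = ∑ s, pp s := by
  simp only [pm]
  exact Finset.sum_fiberwise _ _ _

lemma sum_wt (i : ℤ) : ∑ s : Sm ⊕ Sp, wt φ pp i s = ∑ s, pp s := by
  rw [Fintype.sum_sum_type]
  by_cases hi : i < 0
  · simp [wt, hi, not_le.2 hi, sum_pm]
  · simp [wt, hi, not_lt.1 hi]

lemma sum_negMulLog_wt (i : ℤ) :
    ∑ s : Sm ⊕ Sp, Real.negMulLog (wt φ pp i s)
      = if i < 0 then ∑ t, Real.negMulLog (pm φ pp t) else ∑ s, Real.negMulLog (pp s) := by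
  rw [Fintype.sum_sum_type]
  by_cases hi : i < 0
  · simp [wt, hi, not_le.2 hi]
  · simp [wt, hi, not_lt.1 hi]

variable {φ pp} in
lemma partH_fibPart_restrict (hpp : ∀ s, 0 ≤ pp s) (hsum : ∑ s, pp s = 1)
    [Nonempty Sm] {μ : Measure (ZipSpace Sm Sp)} (hμ : IsProductMeasure φ pp μ) (F : Finset ℤ) :
    partH μ (fibPart (fun (x : ZipSpace Sm Sp) (i : F) => x.1 i))
      = ∑ i ∈ F, ∑ s : Sm ⊕ Sp, Real.negMulLog (wt φ pp i s) := by
  classical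
  have hcyl : ∀ c : F → Sm ⊕ Sp,
      (μ {x : ZipSpace Sm Sp | (fun i : F => x.1 i) = c}).toReal = ∏ i : F, wt φ pp i (c i) := by
    intro c
    let c' : ℤ → Sm ⊕ Sp := fun i =>
      if h : i ∈ F then c ⟨i, h⟩ else .inl (Classical.arbitrary Sm)
    have hc' : ∀ i : F, c' i = c i := fun i => by simp [c']
    have hset : {x : ZipSpace Sm Sp | (fun i : F => x.1 i) = c}
        = {x | ∀ i ∈ F, x.1 i = c' i} := by
      ext x
      simp only [Set.mem_ofPred_eq, funext_iff, ← hc', Subtype.forall]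
    rw [hset, hμ F c', ENNReal.toReal_prod, ← Finset.prod_coe_sort]
    exact Finset.prod_congr rfl fun i _ => by
      rw [ENNReal.toReal_ofReal (wt_nonneg φ hpp _ _), hc']
  rw [partH_fibPart]
  simp_rw [hcyl]
  rw [sum_negMulLog_prod_s10 (fun i : F => wt φ pp i) fun i => (sum_wt φ pp i).trans hsum]
  exact Finset.sum_coe_sort F fun i => ∑ s : Sm ⊕ Sp, Real.negMulLog (wt φ pp i s)

end Shift

end ZipShiftPaper

/-- `h_μ(σ, 𝒫_n) = H_μ(𝒞_0)` for every `n ≥ 1`. -/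
theorem statement10 {Sm Sp : Type*} [Fintype Sm] [Fintype Sp] [Nonempty Sm] [Nonempty Sp]
    [DecidableEq Sm]
    (φ : Sp → Sm) (hφ : Function.Surjective φ)
    (pp : Sp → ℝ) (hpp : ∀ s, 0 ≤ pp s) (hsum : ∑ s, pp s = 1)
    (μ : Measure (ZipSpace Sm Sp)) (hμ : IsProductMeasure φ pp μ)
    (n : ℕ) (hn : 1 ≤ n) :
    Tendsto (fun k : ℕ =>
        partH μ (dynRefine (zipShift φ) (cylRange (-(n : ℤ)) ((n : ℤ) - 1)) k) / (k : ℝ))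
      atTop (nhds (partH μ (cylPart 0))) := by
  have hF : ∀ k : ℕ, 1 ≤ k →
      partH μ (dynRefine (zipShift φ) (cylRange (-(n : ℤ)) ((n : ℤ) - 1)) k)
        = n * ∑ t, Real.negMulLog (pm φ pp t) + (n + k - 1) * ∑ s, Real.negMulLog (pp s) := by
    intro k hk
    rw [dynRefine_cylRange hφ hn hk, partH_fibPart_restrict hpp hsum hμ,
      ← Finset.Ico_union_Ico_eq_Ico (show -(n : ℤ) ≤ 0 by omega)
        (show (0 : ℤ) ≤ n + k - 1 by omega),
      Finset.sum_union (Finset.Ico_disjoint_Ico_consecutive _ _ _)]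
    simp_rw [sum_negMulLog_wt]
    rw [Finset.sum_congr rfl fun i hi => if_pos (Finset.mem_Ico.1 hi).2,
      Finset.sum_congr rfl fun i hi => if_neg (not_lt.2 (Finset.mem_Ico.1 hi).1)]
    simp only [Finset.sum_const, Int.card_Ico, nsmul_eq_mul]
    congr 2
    · simp
    · obtain ⟨m, hm⟩ : ∃ m : ℕ, n + k = m + 1 := ⟨n + k - 1, by omega⟩
      have hm_real : (n : ℝ) + k = m + 1 := by exact_mod_cast hm
      rw [show ((n : ℤ) + k - 1 - 0).toNat = m by omega, hm_real]
      ring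
  have h₀ : partH μ (cylPart 0) = ∑ s, Real.negMulLog (pp s) := by
    rw [cylPart_eq_fibPart, fibPart_congr (g := fun x (i : ({0} : Finset ℤ)) => x.1 i)
      (by simp [funext_iff]), partH_fibPart_restrict hpp hsum hμ, Finset.sum_singleton,
      sum_negMulLog_wt, if_neg (lt_irrefl 0)]
  rw [h₀]
  set a := ∑ t, Real.negMulLog (pm φ pp t)
  set b := ∑ s, Real.negMulLog (pp s)
  have hlim : Tendsto (fun k : ℕ => (n * a + (n - 1) * b) / (k : ℝ) + b) atTop (nhds b) := by
    simpa using (tendsto_const_div_atTop_nhds_zero_nat (n * a + (n - 1) * b)).add_const b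
  refine hlim.congr' ?_
  filter_upwards [eventually_ge_atTop 1] with k hk
  have hk₀ : (k : ℝ) ≠ 0 := by positivity
  rw [hF k hk]
  field_simp
  ring
end
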